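/- Let K be a separable metric space and let W ⊂ K be a difference of closed sets (W = W₁ \ W₂ with W₁, W₂ closed). Let f : W → ℝ be a bounded function with f ∈ DBSC(W), and let f·χ_W : K → ℝ denote the extension of f by zero off W. Then f·χ_W ∈ DBSC(K) with ‖f·χ_W‖_{D(K)} ≤ 2‖f‖_{D(W)}; if W is open then ‖f·χ_W‖_{D(K)} = ‖f‖_{D(W)}; and if f ∈ SD(W) then f·χ_W ∈ SD(K). -/

import Mathlib

open Filter Topology Set

noncomputable section

/-- A real-valued function is bounded. -/
def BddFun {X : Type*} (f : X → ℝ) : Prop := ∃ C, ∀ x, |f x| ≤ C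

/-- `f ∈ DBSC(X)`: `f` is a difference of bounded lower semicontinuous functions. -/
def MemDBSC {X : Type*} [TopologicalSpace X] (f : X → ℝ) : Prop :=
  ∃ u v : X → ℝ, BddFun u ∧ BddFun v ∧ LowerSemicontinuous u ∧ LowerSemicontinuous v ∧
    f = u - v

/-- The D-norm of `f`. -/
def DNorm {X : Type*} [TopologicalSpace X] (f : X → ℝ) : ℝ :=
  sInf {c | ∃ φ : ℕ → X → ℝ, (∀ j, Continuous (φ j)) ∧ (∀ x, Summable fun j => |φ j x|) ∧
    (∀ x, ∑' j, φ j x = f x) ∧ (∀ x, ∑' j, |φ j x| ≤ c)}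

/-- The sup-norm of `f`. -/
def supNorm {X : Type*} (f : X → ℝ) : ℝ := ⨆ x, |f x|

/-- A simple D-function: a D-function taking finitely many values. -/
def SimpleD {X : Type*} [TopologicalSpace X] (f : X → ℝ) : Prop :=
  MemDBSC f ∧ (Set.range f).Finite

/-- `f ∈ SD(X)`: `f` is a strong D-function. -/
def MemSD {X : Type*} [TopologicalSpace X] (f : X → ℝ) : Prop :=
  ∃ φ : ℕ → X → ℝ, (∀ n, SimpleD (φ n)) ∧
    Tendsto (fun n => DNorm (f - φ n)) atTop (𝓝 0)

/-- `f ∈ B_{1/2}(X)`: `f` is a uniform limit of D-functions. -/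
def MemBHalf {X : Type*} [TopologicalSpace X] (f : X → ℝ) : Prop :=
  ∃ g : ℕ → X → ℝ, (∀ n, MemDBSC (g n)) ∧ TendstoUniformly g f atTop

/-- The upper semicontinuous envelope `Uf`. -/
def uEnv {X : Type*} [TopologicalSpace X] (f : X → ℝ) (x : X) : ℝ :=
  sInf {c | ∃ V : Set X, IsOpen V ∧ x ∈ V ∧ sSup (f '' V) = c}

/-- The lower oscillation of `f` at `x`. -/
def losc {X : Type*} [TopologicalSpace X] (f : X → ℝ) (x : X) : ℝ :=
  sInf {c | ∃ V : Set X, IsOpen V ∧ x ∈ V ∧ sSup ((fun y => |f y - f x|) '' V) = c}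

/-- The oscillation of `f`: `osc f = U (losc f)`. -/
def osc {X : Type*} [TopologicalSpace X] (f : X → ℝ) : X → ℝ := uEnv (losc f)

/-- The oscillation sets `os_n(f, ε)`. -/
def osSet {X : Type*} [TopologicalSpace X] (f : X → ℝ) (ε : ℝ) : ℕ → Set X
  | 0 => Set.univ
  | n + 1 => {x | ∃ h : x ∈ osSet f ε n, ε ≤ osc ((osSet f ε n).restrict f) ⟨x, h⟩}

/-- The `ε`-oscillation index `i(f, ε) = sup {n : os_n(f,ε) ≠ ∅}`. -/
def oscIndex {X : Type*} [TopologicalSpace X] (f : X → ℝ) (ε : ℝ) : ℕ∞ :=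
  ⨆ (m : ℕ) (_ : (osSet f ε m).Nonempty), (m : ℕ∞)

/-- `f` has finite Baire index. -/
def FiniteBaireIndex {X : Type*} [TopologicalSpace X] (f : X → ℝ) : Prop :=
  ∃ n : ℕ, ∀ ε > 0, osSet f ε n = ∅

/-- The Baire index `i(f) = sup_{ε > 0} i(f, ε)`. -/
def baireIndex {X : Type*} [TopologicalSpace X] (f : X → ℝ) : ℕ∞ :=
  ⨆ (ε : ℝ) (_ : 0 < ε), oscIndex f ε

open scoped ENNReal Classical

/-- `c` bounds the absolute partial sums of some series of continuous functions with sum `f`. -/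
def IsDBound {X : Type*} [TopologicalSpace X] (f : X → ℝ) (c : ℝ) : Prop :=
  ∃ φ : ℕ → X → ℝ, (∀ j, Continuous (φ j)) ∧ (∀ x, Summable fun j => |φ j x|) ∧
    (∀ x, ∑' j, φ j x = f x) ∧ (∀ x, ∑' j, |φ j x| ≤ c)

theorem dNorm_eq_sInf {X : Type*} [TopologicalSpace X] (f : X → ℝ) :
    DNorm f = sInf {c | IsDBound f c} := rfl

theorem IsDBound.nonneg {X : Type*} [TopologicalSpace X] [Nonempty X] {f : X → ℝ} {c : ℝ}
    (h : IsDBound f c) : 0 ≤ c := by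
  obtain ⟨φ, -, -, -, hc⟩ := h
  exact (tsum_nonneg fun j => abs_nonneg _).trans (hc (Classical.arbitrary X))

theorem IsDBound.dNorm_le {X : Type*} [TopologicalSpace X] [Nonempty X] {f : X → ℝ} {c : ℝ}
    (h : IsDBound f c) : DNorm f ≤ c :=
  csInf_le ⟨0, fun _ hc => IsDBound.nonneg hc⟩ h

theorem dNorm_of_isEmpty {X : Type*} [TopologicalSpace X] [IsEmpty X] (f : X → ℝ) :
    DNorm f = 0 := by
  have : {c | IsDBound f c} = univ :=
    eq_univ_of_forall fun c => ⟨fun _ _ => 0, fun _ => continuous_const,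
      isEmptyElim, isEmptyElim, isEmptyElim⟩
  rw [dNorm_eq_sInf, this, Real.sInf_univ]

theorem dNorm_nonneg {X : Type*} [TopologicalSpace X] (f : X → ℝ) : 0 ≤ DNorm f := by
  rcases isEmpty_or_nonempty X with h | h
  · rw [dNorm_of_isEmpty]
  · exact Real.sInf_nonneg fun _ hc => IsDBound.nonneg hc

theorem dNorm_zero {X : Type*} [TopologicalSpace X] : DNorm (fun _ : X => (0 : ℝ)) = 0 := by
  rcases isEmpty_or_nonempty X with h | h
  · exact dNorm_of_isEmpty _
  · refine le_antisymm (IsDBound.dNorm_le ⟨fun _ _ => 0, fun _ => continuous_const, ?_⟩)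
      (dNorm_nonneg _)
    simp

theorem lowerSemicontinuous_tsum_of_nonneg {X : Type*} [TopologicalSpace X] {φ : ℕ → X → ℝ}
    (hφ : ∀ j, Continuous (φ j)) (h0 : ∀ j x, 0 ≤ φ j x) (hs : ∀ x, Summable fun j => φ j x) :
    LowerSemicontinuous fun x => ∑' j, φ j x := by
  intro x y hy
  obtain ⟨s, hsy⟩ := ((hs x).hasSum.eventually (lt_mem_nhds hy)).exists
  have hc : Continuous fun z => ∑ j ∈ s, φ j z := continuous_finsetSum s fun j _ => hφ j
  filter_upwards [hc.continuousAt.eventually (lt_mem_nhds hsy)] with z hz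
  exact hz.trans_le ((hs z).sum_le_tsum s fun j _ => h0 j z)

/-- A nonnegative lower semicontinuous function on a metric space is the sum of a series of
nonnegative continuous functions, obtained from its Lipschitz regularizations. -/
theorem LowerSemicontinuous.exists_hasSum_continuous {X : Type*} [PseudoMetricSpace X]
    {u : X → ℝ} (hu : LowerSemicontinuous u) (h0 : ∀ x, 0 ≤ u x) :
    ∃ g : ℕ → X → ℝ, (∀ j, Continuous (g j)) ∧ (∀ j x, 0 ≤ g j x) ∧
      ∀ x, HasSum (fun j => g j x) (u x) := by
  let h : ℕ → X → ℝ := fun n x => ⨅ y, (u y + n * dist x y)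
  have hbdd : ∀ (n : ℕ) x, BddBelow (range fun y => u y + n * dist x y) := by
    rintro n x
    refine ⟨0, ?_⟩
    rintro _ ⟨y, rfl⟩
    have := h0 y
    positivity
  have hle : ∀ (n : ℕ) x y, h n x ≤ u y + n * dist x y := fun n x y => ciInf_le (hbdd n x) y
  have hge : ∀ (n : ℕ) x c, (∀ y, c ≤ u y + n * dist x y) → c ≤ h n x := fun n x c hc =>
    have : Nonempty X := ⟨x⟩
    le_ciInf hc
  have hcont : ∀ n, Continuous (h n) := by
    intro n
    refine (LipschitzWith.of_le_add_mul (f := h n) (n : NNReal) fun x y => ?_).continuous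
    rw [← sub_le_iff_le_add]
    refine hge n y _ fun z => ?_
    have h1 := hle n x z
    have h2 : (n : ℝ) * dist x z ≤ n * (dist x y + dist y z) := by
      gcongr
      exact dist_triangle x y z
    simp only [NNReal.coe_natCast]
    linarith
  have hmono : ∀ n x, h n x ≤ h (n + 1) x := by
    intro n x
    refine hge _ x _ fun y => (hle n x y).trans ?_
    gcongr
    simp
  have hlim : ∀ x, Tendsto (fun n => h n x) atTop (𝓝 (u x)) := by
    intro x
    refine tendsto_order.2 ⟨fun a ha => ?_, fun a ha => Eventually.of_forall fun n => ?_⟩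
    · obtain ⟨b, hab, hb⟩ := exists_between ha
      obtain ⟨δ, hδ, hball⟩ := Metric.eventually_nhds_iff.1 (hu x b hb)
      obtain ⟨N, hN⟩ := exists_nat_ge (b / δ)
      filter_upwards [eventually_ge_atTop N] with n hn
      refine hab.trans_le (hge n x b fun y => ?_)
      rcases lt_or_ge (dist y x) δ with hd | hd
      · have := hball hd
        have : 0 ≤ (n : ℝ) * dist x y := by positivity
        linarith
      · rw [div_le_iff₀ hδ] at hN
        rw [dist_comm] at hd
        have : (N : ℝ) * δ ≤ n * dist x y := by gcongr
        linarith [h0 y]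
    · have := hle n x x
      simp only [dist_self, mul_zero, add_zero] at this
      exact this.trans_lt ha
  let H : ℕ → X → ℝ := fun n => Nat.casesOn n (fun _ => 0) h
  have hHmono : ∀ n x, H n x ≤ H (n + 1) x := by
    rintro (_ | n) x
    · exact hge 0 x 0 fun y => by simpa using h0 y
    · exact hmono n x
  have hHcont : ∀ n, Continuous (H n) := by
    rintro (_ | n)
    · exact continuous_const
    · exact hcont n
  refine ⟨fun n x => H (n + 1) x - H n x, fun n => (hHcont (n + 1)).sub (hHcont n),
    fun n x => sub_nonneg.2 (hHmono n x), fun x => ?_⟩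
  rw [hasSum_iff_tendsto_nat_of_nonneg fun n => sub_nonneg.2 (hHmono n x)]
  have hsum : ∀ n, ∑ i ∈ Finset.range n, (H (i + 1) x - H i x) = H n x := fun n => by
    rw [Finset.sum_range_sub fun i => H i x]
    exact sub_zero _
  simp only [hsum]
  exact (tendsto_add_atTop_iff_nat 1).1 (hlim x)

theorem isDBound_iff {X : Type*} [PseudoMetricSpace X] {f : X → ℝ} {c : ℝ} :
    IsDBound f c ↔ ∃ u v : X → ℝ, LowerSemicontinuous u ∧ LowerSemicontinuous v ∧
      (∀ x, 0 ≤ u x) ∧ (∀ x, 0 ≤ v x) ∧ (∀ x, f x = u x - v x) ∧ ∀ x, u x + v x ≤ c := by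
  constructor
  · rintro ⟨φ, hφ, hs, hf, hc⟩
    have hp : ∀ x, Summable fun j => max (φ j x) 0 := fun x =>
      (hs x).of_nonneg_of_le (fun j => le_max_right _ _)
        fun j => max_le (le_abs_self _) (abs_nonneg _)
    have hn : ∀ x, Summable fun j => max (-φ j x) 0 := fun x =>
      (hs x).of_nonneg_of_le (fun j => le_max_right _ _)
        fun j => max_le (neg_le_abs _) (abs_nonneg _)
    refine ⟨fun x => ∑' j, max (φ j x) 0, fun x => ∑' j, max (-φ j x) 0,
      lowerSemicontinuous_tsum_of_nonneg (fun j => (hφ j).max continuous_const)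
        (fun _ _ => le_max_right _ _) hp,
      lowerSemicontinuous_tsum_of_nonneg (fun j => (hφ j).neg.max continuous_const)
        (fun _ _ => le_max_right _ _) hn,
      fun x => tsum_nonneg fun _ => le_max_right _ _,
      fun x => tsum_nonneg fun _ => le_max_right _ _, fun x => ?_, fun x => ?_⟩
    · rw [← hf x, ← (hp x).tsum_sub (hn x)]
      refine tsum_congr fun j => ?_
      rcases le_total 0 (φ j x) with h | h <;> simp [h]
    · refine le_of_eq_of_le ?_ (hc x)
      rw [← (hp x).tsum_add (hn x)]
      refine tsum_congr fun j => ?_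
      rcases le_total 0 (φ j x) with h | h <;> simp [h, abs_of_nonneg, abs_of_nonpos]
  · rintro ⟨u, v, hu, hv, hu0, hv0, hf, hc⟩
    obtain ⟨p, hp, hp0, hpu⟩ := hu.exists_hasSum_continuous hu0
    obtain ⟨q, hq, hq0, hqv⟩ := hv.exists_hasSum_continuous hv0
    let φ : ℕ → X → ℝ := fun n x => if Even n then p (n / 2) x else -q (n / 2) x
    have he : ∀ k x, φ (2 * k) x = p k x := fun k x => by simp [φ]
    have ho : ∀ k x, φ (2 * k + 1) x = -q k x := fun k x => by
      have : (2 * k + 1) / 2 = k := by omega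
      simp [φ, this]
    have hsum : ∀ x, HasSum (fun n => φ n x) (f x) := fun x => by
      rw [hf x, sub_eq_add_neg]
      refine HasSum.even_add_odd ?_ ?_
      · simpa only [he] using hpu x
      · simpa only [ho] using (hqv x).neg
    have habs : ∀ x, HasSum (fun n => |φ n x|) (u x + v x) := fun x => by
      refine HasSum.even_add_odd ?_ ?_
      · simpa only [he, abs_of_nonneg (hp0 _ x)] using hpu x
      · simpa only [ho, abs_neg, abs_of_nonneg (hq0 _ x)] using hqv x
    refine ⟨φ, fun n => ?_, fun x => (habs x).summable, fun x => (hsum x).tsum_eq,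
      fun x => (habs x).tsum_eq.trans_le (hc x)⟩
    by_cases hn : Even n
    · simpa only [φ, if_pos hn] using hp _
    · simp only [φ, if_neg hn]
      exact (hq _).neg

theorem MemDBSC.exists_isDBound {X : Type*} [PseudoMetricSpace X] {f : X → ℝ} (hf : MemDBSC f) :
    ∃ c, IsDBound f c := by
  obtain ⟨u, v, ⟨a, ha⟩, ⟨b, hb⟩, hu, hv, rfl⟩ := hf
  let d := max a b
  have hd : ∀ x, |u x| ≤ d ∧ |v x| ≤ d := fun x =>
    ⟨(ha x).trans (le_max_left _ _), (hb x).trans (le_max_right _ _)⟩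
  refine ⟨4 * d, isDBound_iff.2 ⟨fun x => u x + d, fun x => v x + d,
    hu.add lowerSemicontinuous_const, hv.add lowerSemicontinuous_const,
    fun x => ?_, fun x => ?_, fun x => ?_, fun x => ?_⟩⟩
  · linarith [(abs_le.1 (hd x).1).1]
  · linarith [(abs_le.1 (hd x).2).1]
  · simp
  · linarith [(abs_le.1 (hd x).1).2, (abs_le.1 (hd x).2).2]

theorem IsDBound.memDBSC {X : Type*} [PseudoMetricSpace X] {f : X → ℝ} {c : ℝ}
    (h : IsDBound f c) : MemDBSC f := by
  obtain ⟨u, v, hu, hv, hu0, hv0, hf, hc⟩ := isDBound_iff.1 h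
  refine ⟨u, v, ⟨c, fun x => ?_⟩, ⟨c, fun x => ?_⟩, hu, hv, funext hf⟩
  · rw [abs_of_nonneg (hu0 x)]
    linarith [hc x, hv0 x]
  · rw [abs_of_nonneg (hv0 x)]
    linarith [hc x, hu0 x]

theorem MemDBSC.sub {X : Type*} [TopologicalSpace X] {f g : X → ℝ} (hf : MemDBSC f)
    (hg : MemDBSC g) : MemDBSC (f - g) := by
  obtain ⟨u, v, ⟨a, ha⟩, ⟨b, hb⟩, hu, hv, rfl⟩ := hf
  obtain ⟨u', v', ⟨a', ha'⟩, ⟨b', hb'⟩, hu', hv', rfl⟩ := hg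
  exact ⟨u + v', v + u',
    ⟨a + b', fun x => (abs_add_le _ _).trans (add_le_add (ha x) (hb' x))⟩,
    ⟨b + a', fun x => (abs_add_le _ _).trans (add_le_add (hb x) (ha' x))⟩,
    hu.add hv', hv.add hu', by abel⟩

open scoped Classical in
/-- The extension by zero of a function defined on `W`. -/
def zeroExtend {K : Type*} (W : Set K) (f : W → ℝ) (x : K) : ℝ :=
  if h : x ∈ W then f ⟨x, h⟩ else 0

open scoped Classical in
/-- A lower semicontinuous function on `A \ B` with values in `[0, c]` stays lower semicontinuous
when extended by `0` on `A ∩ B` and by `c` off `A`. -/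
theorem LowerSemicontinuous.extend_sdiff {K : Type*} [TopologicalSpace K] {A B : Set K}
    (hA : IsClosed A) (hB : IsClosed B) {u : ↥(A \ B) → ℝ} {c : ℝ} (hu : LowerSemicontinuous u)
    (h0 : ∀ x, 0 ≤ u x) (hc : ∀ x, u x ≤ c) (hc0 : 0 ≤ c) :
    LowerSemicontinuous fun x : K =>
      if h : x ∈ A \ B then u ⟨x, h⟩ else if x ∈ A then 0 else c := by
  intro x y hy
  by_cases hxA : x ∈ A
  · by_cases hxB : x ∈ B
    · simp only [Set.mem_sdiff, hxA, hxB, not_true_eq_false, and_false, dite_false, if_true] at hy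
      refine Eventually.of_forall fun z => hy.trans_le ?_
      dsimp only
      split_ifs
      exacts [h0 _, le_rfl, hc0]
    · have hxW : x ∈ A \ B := ⟨hxA, hxB⟩
      simp only [dif_pos hxW] at hy
      have hev := hu ⟨x, hxW⟩ y hy
      rw [nhds_subtype_eq_comap, eventually_comap] at hev
      filter_upwards [hev, hB.isOpen_compl.mem_nhds hxB] with z hz hzB
      by_cases hzA : z ∈ A
      · rw [dif_pos ⟨hzA, hzB⟩]
        exact hz ⟨z, hzA, hzB⟩ rfl
      · simp only [Set.mem_sdiff, hzA, false_and, dite_false, if_false]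
        exact hy.trans_le (hc _)
  · filter_upwards [hA.isOpen_compl.mem_nhds hxA] with z hz
    have hzA : z ∉ A := hz
    simp only [Set.mem_sdiff, hxA, hzA, false_and, dite_false, if_false] at hy ⊢
    exact hy

theorem IsDBound.zeroExtend_sdiff {K : Type*} [PseudoMetricSpace K] {A B : Set K}
    (hA : IsClosed A) (hB : IsClosed B) {f : ↥(A \ B) → ℝ} {c : ℝ} (hc0 : 0 ≤ c)
    (h : IsDBound f c) : IsDBound (zeroExtend (A \ B) f) (2 * c) := by
  obtain ⟨u, v, hu, hv, hu0, hv0, hf, hc⟩ := isDBound_iff.1 h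
  refine isDBound_iff.2 ⟨_, _,
    hu.extend_sdiff hA hB hu0 (fun x => by linarith [hc x, hv0 x]) hc0,
    hv.extend_sdiff hA hB hv0 (fun x => by linarith [hc x, hu0 x]) hc0,
    fun x => ?_, fun x => ?_, fun x => ?_, fun x => ?_⟩
  · split_ifs
    exacts [hu0 _, le_rfl, hc0]
  · split_ifs
    exacts [hv0 _, le_rfl, hc0]
  · rw [zeroExtend]
    split_ifs
    exacts [hf _, by simp, by simp]
  · split_ifs
    exacts [by linarith [hc ⟨x, ‹_›⟩], by linarith, by linarith]

theorem IsDBound.zeroExtend_of_isOpen {K : Type*} [PseudoMetricSpace K] {W : Set K}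
    (hW : IsOpen W) {f : W → ℝ} {c : ℝ} (hc0 : 0 ≤ c) (h : IsDBound f c) :
    IsDBound (zeroExtend W f) c := by
  obtain ⟨B, hB, rfl⟩ : ∃ B : Set K, IsClosed B ∧ W = univ \ B :=
    ⟨Wᶜ, hW.isClosed_compl, by simp⟩
  obtain ⟨u, v, hu, hv, hu0, hv0, hf, hc⟩ := isDBound_iff.1 h
  refine isDBound_iff.2 ⟨_, _,
    hu.extend_sdiff isClosed_univ hB hu0 (fun x => by linarith [hc x, hv0 x]) hc0,
    hv.extend_sdiff isClosed_univ hB hv0 (fun x => by linarith [hc x, hu0 x]) hc0,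
    fun x => ?_, fun x => ?_, fun x => ?_, fun x => ?_⟩
  · split_ifs
    exacts [hu0 _, le_rfl, hc0]
  · split_ifs
    exacts [hv0 _, le_rfl, hc0]
  · rw [zeroExtend]
    split_ifs
    exacts [hf _, by simp, by simp]
  · split_ifs with h1 h2
    exacts [hc _, by linarith, absurd (mem_univ x) h2]

theorem IsDBound.of_zeroExtend {K : Type*} [TopologicalSpace K] {W : Set K} {f : W → ℝ} {c : ℝ}
    (h : IsDBound (zeroExtend W f) c) : IsDBound f c := by
  obtain ⟨φ, hφ, hs, hf, hc⟩ := h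
  refine ⟨fun j x => φ j x, fun j => (hφ j).comp continuous_subtype_val, fun x => hs x,
    fun x => ?_, fun x => hc x⟩
  rw [hf, zeroExtend, dif_pos x.2]

theorem zeroExtend_of_isEmpty {K : Type*} {W : Set K} [IsEmpty W] (f : W → ℝ) :
    zeroExtend W f = fun _ => 0 :=
  funext fun x => dif_neg fun h => isEmptyElim (⟨x, h⟩ : W)

theorem zeroExtend_sub {K : Type*} {W : Set K} (f g : W → ℝ) :
    zeroExtend W (f - g) = zeroExtend W f - zeroExtend W g := by
  ext x
  by_cases h : x ∈ W <;> simp [zeroExtend, h]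

theorem finite_range_zeroExtend {K : Type*} {W : Set K} {f : W → ℝ} (hf : (range f).Finite) :
    (range (zeroExtend W f)).Finite := by
  refine (hf.insert 0).subset ?_
  rintro _ ⟨x, rfl⟩
  by_cases h : x ∈ W
  · exact Or.inr ⟨⟨x, h⟩, by simp [zeroExtend, h]⟩
  · exact Or.inl (by simp [zeroExtend, h])

theorem MemDBSC.zeroExtend_sdiff {K : Type*} [PseudoMetricSpace K] {A B : Set K}
    (hA : IsClosed A) (hB : IsClosed B) {f : ↥(A \ B) → ℝ} (hf : MemDBSC f) :
    MemDBSC (zeroExtend (A \ B) f) := by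
  rcases isEmpty_or_nonempty ↥(A \ B) with h | h
  · rw [zeroExtend_of_isEmpty]
    exact ⟨0, 0, ⟨0, by simp⟩, ⟨0, by simp⟩, lowerSemicontinuous_const,
      lowerSemicontinuous_const, (sub_zero _).symm⟩
  · obtain ⟨c, hc⟩ := hf.exists_isDBound
    exact (hc.zeroExtend_sdiff hA hB hc.nonneg).memDBSC

theorem MemDBSC.dNorm_zeroExtend_sdiff_le {K : Type*} [PseudoMetricSpace K] {A B : Set K}
    (hA : IsClosed A) (hB : IsClosed B) {f : ↥(A \ B) → ℝ} (hf : MemDBSC f) :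
    DNorm (zeroExtend (A \ B) f) ≤ 2 * DNorm f := by
  rcases isEmpty_or_nonempty ↥(A \ B) with h | h
  · rw [zeroExtend_of_isEmpty, dNorm_zero, dNorm_of_isEmpty, mul_zero]
  · have : Nonempty K := h.map Subtype.val
    have : DNorm (zeroExtend (A \ B) f) / 2 ≤ DNorm f := by
      refine le_csInf hf.exists_isDBound fun c (hc : IsDBound f c) => ?_
      linarith [(hc.zeroExtend_sdiff hA hB hc.nonneg).dNorm_le]
    linarith

theorem dNorm_zeroExtend_of_isOpen {K : Type*} [PseudoMetricSpace K] {W : Set K}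
    (hW : IsOpen W) (f : W → ℝ) : DNorm (zeroExtend W f) = DNorm f := by
  rcases isEmpty_or_nonempty W with h | h
  · rw [zeroExtend_of_isEmpty, dNorm_zero, dNorm_of_isEmpty]
  · rw [dNorm_eq_sInf, dNorm_eq_sInf]
    congr 1
    ext c
    exact ⟨IsDBound.of_zeroExtend,
      fun hc => IsDBound.zeroExtend_of_isOpen hW (IsDBound.nonneg hc) hc⟩

theorem MemSD.zeroExtend_sdiff {K : Type*} [PseudoMetricSpace K] {A B : Set K}
    (hA : IsClosed A) (hB : IsClosed B) {f : ↥(A \ B) → ℝ} (hf : MemDBSC f) (hs : MemSD f) :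
    MemSD (zeroExtend (A \ B) f) := by
  obtain ⟨φ, hφ, hlim⟩ := hs
  refine ⟨fun n => zeroExtend (A \ B) (φ n),
    fun n => ⟨(hφ n).1.zeroExtend_sdiff hA hB, finite_range_zeroExtend (hφ n).2⟩, ?_⟩
  refine squeeze_zero (fun n => dNorm_nonneg _) (fun n => ?_) (by simpa using hlim.const_mul 2)
  rw [← zeroExtend_sub]
  exact (hf.sub (hφ n).1).dNorm_zeroExtend_sdiff_le hA hB

/-- **Lemma 2.4.** Extension by zero from a difference of closed sets. -/
theorem extension_from_difference_of_closed {K : Type*} [MetricSpace K]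
    [TopologicalSpace.SeparableSpace K] (A B : Set K) (hA : IsClosed A)
    (hB : IsClosed B) (W : Set K) (hW : W = A \ B) (f : ↥W → ℝ)
    (hb : BddFun f) (hf : MemDBSC f) :
    MemDBSC (fun x : K => if h : x ∈ W then f ⟨x, h⟩ else 0) ∧
    DNorm (fun x : K => if h : x ∈ W then f ⟨x, h⟩ else 0) ≤ 2 * DNorm f ∧
    (IsOpen W → DNorm (fun x : K => if h : x ∈ W then f ⟨x, h⟩ else 0) = DNorm f) ∧
    (MemSD f → MemSD (fun x : K => if h : x ∈ W then f ⟨x, h⟩ else 0)) := by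
  subst hW
  exact ⟨hf.zeroExtend_sdiff hA hB, hf.dNorm_zeroExtend_sdiff_le hA hB,
    fun hW => dNorm_zeroExtend_of_isOpen hW f, fun hs => hs.zeroExtend_sdiff hA hB hf⟩
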